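/- Fix N ≥ 1 and let V = (ℤ/Nℤ)². Define T₁(x,y) = (x + 2y, y) and T₂(x,y) = (x, 2x + y) on V (so T₁, T₂ are the actions of the matrices [[1,2],[0,1]] and [[1,0],[2,1]] modulo N), with inverses T₁⁻¹(x,y) = (x − 2y, y), T₂⁻¹(x,y) = (x, y − 2x). Let e₁ = (1,0), e₂ = (0,1), and define the eight bijections σ₁(v) = T₁v, σ₂(v) = T₁v + e₁, σ₃(v) = T₂v, σ₄(v) = T₂v + e₂, σ₅(v) = T₁⁻¹v, σ₆(v) = T₁⁻¹(v − e₁), σ₇(v) = T₂⁻¹v, σ₈(v) = T₂⁻¹(v − e₂). Define (Of)(v) = (1/8) ∑_{k=1}^8 f(σ_k(v)). Then for every f : V → ℝ with ∑_{v ∈ V} f(v) = 0, one has (∑_v (Of)(v)²)^{1/2} ≤ (5√2/8)·(∑_v f(v)²)^{1/2}. -/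

import Mathlib

/-- The matrix action `T₁(x,y) = (x + 2y, y)` on `(ℤ/Nℤ)²`. -/
def ggT1 {N : ℕ} (v : ZMod N × ZMod N) : ZMod N × ZMod N := (v.1 + 2 * v.2, v.2)

/-- The matrix action `T₂(x,y) = (x, 2x + y)` on `(ℤ/Nℤ)²`. -/
def ggT2 {N : ℕ} (v : ZMod N × ZMod N) : ZMod N × ZMod N := (v.1, 2 * v.1 + v.2)

/-- The inverse action `T₁⁻¹(x,y) = (x − 2y, y)`. -/
def ggT1inv {N : ℕ} (v : ZMod N × ZMod N) : ZMod N × ZMod N := (v.1 - 2 * v.2, v.2)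

/-- The inverse action `T₂⁻¹(x,y) = (x, y − 2x)`. -/
def ggT2inv {N : ℕ} (v : ZMod N × ZMod N) : ZMod N × ZMod N := (v.1, v.2 - 2 * v.1)

/-- First standard basis vector `e₁ = (1,0)`. -/
def ggE1 {N : ℕ} : ZMod N × ZMod N := (1, 0)

/-- Second standard basis vector `e₂ = (0,1)`. -/
def ggE2 {N : ℕ} : ZMod N × ZMod N := (0, 1)

/-- The normalized adjacency (averaging) operator of the Gabber–Galil–Margulis
8-regular Schreier graph on `(ℤ/Nℤ)²`. -/
noncomputable def ggO {N : ℕ} (f : ZMod N × ZMod N → ℝ) (v : ZMod N × ZMod N) : ℝ :=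
  (1 / 8) * (f (ggT1 v) + f (ggT1 v + ggE1) + f (ggT2 v) + f (ggT2 v + ggE2)
    + f (ggT1inv v) + f (ggT1inv (v - ggE1)) + f (ggT2inv v) + f (ggT2inv (v - ggE2)))


/-- absolute value of the centered representative -/
def ggm {N : ℕ} (a : ZMod N) : ℕ := a.valMinAbs.natAbs

lemma ggm_neg {N : ℕ} (a : ZMod N) : ggm (-a) = ggm a := ZMod.natAbs_valMinAbs_neg a

lemma ggm_le {N : ℕ} [NeZero N] (a : ZMod N) : 2 * ggm a ≤ N := by
  have := ZMod.natAbs_valMinAbs_le a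
  unfold ggm; omega

lemma ggm_eq_or {N : ℕ} [NeZero N] (a : ZMod N) :
    a = ((ggm a : ℕ) : ZMod N) ∨ a = -((ggm a : ℕ) : ZMod N) := by
  have h := ZMod.coe_valMinAbs a
  rcases Int.natAbs_eq a.valMinAbs with h1 | h1
  · left; conv_lhs => rw [← h, h1]
    simp [ggm]
  · right; conv_lhs => rw [← h, h1]
    simp [ggm]

lemma ggm_int {N : ℕ} [NeZero N] (k : ℤ) (hk : 2 * |k| ≤ 3 * N) :
    ∃ r : ℤ, ggm (k : ZMod N) = r.natAbs ∧ -(N : ℤ) < 2 * r ∧ 2 * r ≤ N ∧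
      (k = r ∨ k = r + N ∨ k = r - N ∨ k = r + 2 * N ∨ k = r - 2 * N) := by
  have hN : (0 : ℤ) < N := by exact_mod_cast Nat.pos_of_ne_zero (NeZero.ne N)
  have h := ZMod.valMinAbs_mem_Ioc (k : ZMod N)
  have h2 := ZMod.coe_valMinAbs (k : ZMod N)
  rw [ZMod.intCast_eq_intCast_iff_dvd_sub] at h2
  obtain ⟨q, hq⟩ := h2
  obtain ⟨h3, h4⟩ := h
  refine ⟨(k : ZMod N).valMinAbs, rfl, by linarith, by linarith, ?_⟩
  obtain ⟨h5, h6⟩ := abs_le.mp (show |k| ≤ |k| from le_rfl)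
  have hq1 : q < 3 := by
    by_contra hc
    push Not at hc
    nlinarith
  have hq2 : -3 < q := by
    by_contra hc
    push Not at hc
    nlinarith
  interval_cases q <;> omega

/-- weight -/
noncomputable def ggg (p q : ℕ) : ℝ :=
  if q < p then √2 else if p < q then √2 / 2 else 1

noncomputable def ggG {N : ℕ} (a b : ZMod N) : ℝ :=
  ggg (ggm b) (ggm (b + 2 * a)) + ggg (ggm b) (ggm (b - 2 * a))

lemma ggG_neg1 {N : ℕ} (a b : ZMod N) : ggG (-a) b = ggG a b := by
  unfold ggG
  rw [show b + 2 * -a = b - 2 * a by ring, show b - 2 * -a = b + 2 * a by ring, add_comm]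

lemma ggG_neg2 {N : ℕ} (a b : ZMod N) : ggG a (-b) = ggG a b := by
  unfold ggG
  rw [show -b + 2 * a = -(b - 2 * a) by ring, show -b - 2 * a = -(b + 2 * a) by ring, 
    ggm_neg, ggm_neg, ggm_neg, add_comm]

lemma ggG_eq {N : ℕ} [NeZero N] (a b : ZMod N) :
    ggG a b = ggG ((ggm a : ℕ) : ZMod N) ((ggm b : ℕ) : ZMod N) := by
  rcases ggm_eq_or a with h | h <;> rcases ggm_eq_or b with h' | h' <;>
  · conv_lhs => rw [h, h']
    try simp only [ggG_neg1, ggG_neg2]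

lemma ggs1 : (1.414 : ℝ) < √2 := by
  apply Real.lt_sqrt_of_sq_lt; norm_num
lemma ggs2 : √2 < (1.415 : ℝ) := by
  rw [Real.sqrt_lt' (by norm_num)]; norm_num

lemma ggg_le (p q : ℕ) : ggg p q ≤ √2 := by
  have := ggs1
  unfold ggg; split_ifs <;> linarith
lemma ggg_nonneg (p q : ℕ) : 0 < ggg p q := by
  have := ggs1
  unfold ggg; split_ifs <;> linarith
lemma ggg_inv (p q : ℕ) : ggg p q * ggg q p = 1 := by
  have : √2 * √2 = 2 := Real.mul_self_sqrt (by norm_num)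
  unfold ggg; split_ifs <;> first | omega | nlinarith
lemma ggg_lt {p q : ℕ} (h : p < q) : ggg p q = √2 / 2 := by
  unfold ggg; rw [if_neg (by omega), if_pos h]
lemma ggg_eq {p q : ℕ} (h : p = q) : ggg p q = 1 := by
  unfold ggg; rw [if_neg (by omega), if_neg (by omega)]

lemma ggPQ {N : ℕ} [NeZero N] (X Y : ℕ) (hX : 2 * X ≤ N) (hY : 2 * Y ≤ N) :
    ∃ P Q : ℕ, ggG (X : ZMod N) (Y : ZMod N) = ggg Y P + ggg Y Q ∧
      (2 * (X + Y) < N → X ≠ 0 → Y < P) ∧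
      (X = 0 → P = Y ∧ Q = Y) ∧
      (Y < X → 2 * X < N → Y < Q) ∧
      (X = Y → Q = Y) := by
  refine ⟨ggm ((Y : ZMod N) + 2 * (X : ZMod N)), ggm ((Y : ZMod N) - 2 * (X : ZMod N)), ?_, ?_⟩
  · unfold ggG
    have : ggm (Y : ZMod N) = Y := by
      obtain ⟨r, h1, h2, h3, h4⟩ := ggm_int (N := N) (Y : ℤ) (by
        rw [abs_of_nonneg (by positivity)]; omega)
      simp only [Int.cast_natCast] at h1
      omega
    rw [this]
  obtain ⟨r, h1, h2, h3, h4⟩ := ggm_int (N := N) (Y + 2 * X : ℤ) (by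
    rw [abs_of_nonneg (by positivity)]; omega)
  obtain ⟨r', h1', h2', h3', h4'⟩ := ggm_int (N := N) (Y - 2 * X : ℤ) (by
    have : |(Y : ℤ) - 2 * X| ≤ N := by rw [abs_le]; omega
    omega)
  push_cast at h1 h1'
  rw [h1, h1']
  refine ⟨?_, ?_, ?_, ?_⟩ <;> omega

lemma ggcos {N : ℕ} [NeZero N] (X : ℕ) (hX : 2 * X ≤ N) :
    0 ≤ Real.cos (Real.pi * X / N) ∧ Real.cos (Real.pi * X / N) ≤ 1 := by
  have hN : (0 : ℝ) < N := by exact_mod_cast Nat.pos_of_ne_zero (NeZero.ne N)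
  have hX' : (2 * X : ℝ) ≤ N := by exact_mod_cast hX
  refine ⟨Real.cos_nonneg_of_neg_pi_div_two_le_of_le ?_ ?_, Real.cos_le_one _⟩
  · have : 0 ≤ Real.pi * X / N := by positivity
    linarith [Real.pi_pos]
  · rw [div_le_iff₀ hN]; nlinarith [Real.pi_pos]

/-- main pointwise estimate for X ≤ Y -/
lemma gg_key1 {N : ℕ} [NeZero N] (X Y : ℕ) (hXY : X ≤ Y) (hY0 : Y ≠ 0)
    (hY : 2 * Y ≤ N) :
    Real.cos (Real.pi * X / N) * ggG (X : ZMod N) (Y : ZMod N) +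
      Real.cos (Real.pi * Y / N) * ggG (Y : ZMod N) (X : ZMod N) ≤ 5 * √2 / 2 := by
  have hN : (0 : ℝ) < N := by exact_mod_cast Nat.pos_of_ne_zero (NeZero.ne N)
  have hX : 2 * X ≤ N := by omega
  have hs1 := ggs1
  have hs2 := ggs2
  have hs : √2 * √2 = 2 := Real.mul_self_sqrt (by norm_num)
  obtain ⟨c0, c1⟩ := ggcos (N := N) X hX
  obtain ⟨d0, d1⟩ := ggcos (N := N) Y hY
  obtain ⟨P, Q, hG, hP, h0, hQ, hE⟩ := ggPQ (N := N) X Y hX hY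
  obtain ⟨P', Q', hG', hP', h0', hQ', hE'⟩ := ggPQ (N := N) Y X hY hX
  rw [hG, hG']
  have l1 := ggg_le Y P
  have l2 := ggg_le Y Q
  have l3 := ggg_le X P'
  have l4 := ggg_le X Q'
  have p1 := ggg_nonneg Y P
  have p2 := ggg_nonneg Y Q
  have p3 := ggg_nonneg X P'
  have p4 := ggg_nonneg X Q'
  by_cases hin : 2 * (X + Y) < N
  · have e3 : ggg X P' = √2 / 2 := ggg_lt (hP' (by omega) hY0)
    suffices h : (ggg Y P + ggg Y Q) + (ggg X P' + ggg X Q') ≤ 5 * √2 / 2 by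
      nlinarith [mul_nonneg (sub_nonneg.2 c1) (add_pos p1 p2).le,
        mul_nonneg (sub_nonneg.2 d1) (add_pos p3 p4).le]
    rcases Nat.eq_zero_or_pos X with hz | hpos
    · have e1 := ggg_eq (h0 hz).1.symm
      have e2 := ggg_eq (h0 hz).2.symm
      have e4 : ggg X Q' = √2 / 2 := ggg_lt (hQ' (by omega) (by omega))
      linarith
    have e1 : ggg Y P = √2 / 2 := ggg_lt (hP (by omega) (by omega))
    rcases hXY.eq_or_lt with he | hlt
    · have e2 := ggg_eq (hE he).symm
      have e4 := ggg_eq (hE' he.symm).symm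
      linarith
    · have e4 : ggg X Q' = √2 / 2 := ggg_lt (hQ' hlt (by omega))
      linarith
  · have hpi := Real.pi_pos
    have hX' : (2 * X : ℝ) ≤ N := by exact_mod_cast hX
    have hY' : (2 * Y : ℝ) ≤ N := by exact_mod_cast hY
    have hsum : (N : ℝ) ≤ 2 * (X + Y) := by exact_mod_cast not_lt.mp hin
    have hXYr : (X : ℝ) ≤ Y := by exact_mod_cast hXY
    set x := Real.pi * X / N with hx
    set y := Real.pi * Y / N with hy
    have hxy : x ≤ y := by rw [hx, hy]; gcongr
    have hx0 : 0 ≤ x := by positivity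
    have hy2 : y ≤ Real.pi / 2 := by rw [hy, div_le_iff₀ hN]; nlinarith
    have hS : Real.pi / 2 - x ≤ y := by
      have : Real.pi / 2 ≤ (Real.pi * X + Real.pi * Y) / N := by
        rw [le_div_iff₀ hN]; nlinarith
      rw [add_div] at this
      linarith
    have hcd : Real.cos y ≤ Real.cos x :=
      Real.cos_le_cos_of_nonneg_of_le_pi hx0 (by linarith) hxy
    have hds : Real.cos y ≤ Real.sin x := by
      rw [← Real.cos_pi_div_two_sub]
      exact Real.cos_le_cos_of_nonneg_of_le_pi (by linarith) (by linarith) hS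
    have hcs := Real.sin_sq_add_cos_sq x
    have hq : 2 * Real.cos x + 3 / 2 * Real.cos y ≤ 5 / 2 := by
      nlinarith [sq_nonneg (3 * Real.cos x - 4 * Real.sin x)]
    rcases hXY.eq_or_lt with he | hlt
    · have e2 := ggg_eq (hE he).symm
      have e4 := ggg_eq (hE' he.symm).symm
      have hyx : y = x := by rw [hx, hy, he]
      rw [e2, e4]
      have : Real.cos x ≤ √2 / 2 := by
        rw [hyx] at hds
        by_contra hc
        push Not at hc
        nlinarith
      rw [hyx]
      nlinarith
    · have e4 : Real.cos y * ggg X Q' ≤ Real.cos y * (√2 / 2) := by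
        by_cases hh : 2 * Y < N
        · rw [ggg_lt (hQ' hlt hh)]
        · have : y = Real.pi / 2 := by
            have : (N : ℝ) = 2 * Y := by exact_mod_cast (by omega : N = 2 * Y)
            rw [hy, this]
            have : (Y : ℝ) ≠ 0 := by exact_mod_cast hY0
            field_simp
          rw [this, Real.cos_pi_div_two]; simp
      have := mul_le_mul_of_nonneg_left l3 d0
      have := mul_le_mul_of_nonneg_left (add_le_add l1 l2) c0
      have := mul_le_mul_of_nonneg_left hq (Real.sqrt_nonneg 2)
      linarith

lemma gg_key {N : ℕ} [NeZero N] (a b : ZMod N) (h : ¬ (a = 0 ∧ b = 0)) :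
    2 * Real.cos (Real.pi * ggm a / N) * ggG a b +
      2 * Real.cos (Real.pi * ggm b / N) * ggG b a ≤ 5 * √2 := by
  have h0 : ¬ (ggm a = 0 ∧ ggm b = 0) := by
    simpa [ggm, Int.natAbs_eq_zero, ZMod.valMinAbs_eq_zero] using h
  rw [ggG_eq a b, ggG_eq b a]
  rcases le_total (ggm a) (ggm b) with hl | hl
  · linarith [gg_key1 (N := N) _ _ hl (by omega) (ggm_le b)]
  · linarith [gg_key1 (N := N) _ _ hl (by omega) (ggm_le a)]

open ZMod in
lemma gg_conj {N : ℕ} [NeZero N] (a : ZMod N) :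
    (starRingEnd ℂ) (stdAddChar a) = stdAddChar (-a) := by
  rw [AddChar.map_neg_eq_conj]

lemma gg_norm {N : ℕ} [NeZero N] (a : ZMod N) :
    ‖1 + ZMod.stdAddChar a‖ = 2 * Real.cos (Real.pi * ggm a / N) ∧ 
    ‖1 + ZMod.stdAddChar (-a)‖ = 2 * Real.cos (Real.pi * ggm a / N) := by
  have hN : (N : ℂ) ≠ 0 := by exact_mod_cast NeZero.ne N
  have h1 : ∀ b : ZMod N, ‖1 + ZMod.stdAddChar (-b)‖ = ‖1 + ZMod.stdAddChar b‖ := by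
    intro b
    rw [← gg_conj, ← Complex.norm_conj]
    simp
  have h2 : ‖1 + ZMod.stdAddChar ((ggm a : ℕ) : ZMod N)‖ =
      2 * Real.cos (Real.pi * ggm a / N) := by
    have h3 := ZMod.stdAddChar_coe (N := N) (ggm a : ℤ)
    push_cast at h3
    rw [h3]
    set θ : ℝ := Real.pi * ggm a / N with hθ
    have h4 : (2 * Real.pi * Complex.I * (ggm a : ℂ) / N) = (θ * Complex.I) + θ * Complex.I := by
      rw [hθ]; push_cast; field_simp; ring
    have h5 : 1 + Complex.exp (θ * Complex.I + θ * Complex.I) =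
        Complex.exp (θ * Complex.I) * ((2 * Real.cos θ : ℝ) : ℂ) := by
      push_cast
      rw [Complex.two_cos, mul_add, ← Complex.exp_add, ← Complex.exp_add]
      simp [add_comm]
    rw [h4, h5, norm_mul, Complex.norm_exp_ofReal_mul_I, one_mul, Complex.norm_real,
      Real.norm_of_nonneg]
    have := (ggcos (N := N) (ggm a) (ggm_le a)).1
    positivity
  rw [h1 a, and_self, ← h2]
  rcases ggm_eq_or a with h | h
  · conv_lhs => rw [h]
  · conv_lhs => rw [h, h1]

lemma gg_parseval1 {N : ℕ} [NeZero N] (h : ZMod N → ℂ) :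
    ∑ a : ZMod N, ‖∑ x, h x * ZMod.stdAddChar (a * x)‖ ^ 2 = N * ∑ x, ‖h x‖ ^ 2 := by
  have key : ((∑ a : ZMod N, ‖∑ x, h x * ZMod.stdAddChar (a * x)‖ ^ 2 : ℝ) : ℂ) =
      ((N * ∑ x, ‖h x‖ ^ 2 : ℝ) : ℂ) := by
    push_cast
    simp_rw [← Complex.mul_conj', map_sum, map_mul, gg_conj, Finset.sum_mul_sum]
    rw [Finset.sum_comm, Finset.mul_sum]
    refine Finset.sum_congr rfl fun x _ => ?_
    rw [Finset.sum_comm]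
    have : ∀ y, ∑ a : ZMod N, h x * ZMod.stdAddChar (a * x) *
        ((starRingEnd ℂ) (h y) * ZMod.stdAddChar (-(a * y))) =
        if x = y then h x * (starRingEnd ℂ) (h y) * N else 0 := by
      intro y
      have h1 : ∀ a : ZMod N, h x * ZMod.stdAddChar (a * x) *
        ((starRingEnd ℂ) (h y) * ZMod.stdAddChar (-(a * y))) =
        h x * (starRingEnd ℂ) (h y) * ZMod.stdAddChar (a * (x - y)) := by
        intro a
        rw [mul_sub, sub_eq_add_neg, AddChar.map_add_eq_mul]; ring
      simp_rw [h1, ← Finset.mul_sum, AddChar.sum_mulShift _ (ZMod.isPrimitive_stdAddChar N),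
        sub_eq_zero]
      split_ifs <;> simp
    simp_rw [this]
    simp
    ring
  exact_mod_cast key

/-- Fourier transform -/
noncomputable def ggF {N : ℕ} [NeZero N] (f : ZMod N × ZMod N → ℝ) (a b : ZMod N) : ℂ :=
  ∑ v : ZMod N × ZMod N, (f v : ℂ) * ZMod.stdAddChar (a * v.1 + b * v.2)

lemma gg_parseval {N : ℕ} [NeZero N] (f : ZMod N × ZMod N → ℝ) :
    ∑ a, ∑ b, ‖ggF f a b‖ ^ 2 = N ^ 2 * ∑ v, f v ^ 2 := by
  have h1 : ∀ a b, ggF f a b =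
      ∑ y, (∑ x, (f (x, y) : ℂ) * ZMod.stdAddChar (a * x)) * ZMod.stdAddChar (b * y) := by
    intro a b
    unfold ggF
    rw [Fintype.sum_prod_type_right]
    refine Finset.sum_congr rfl fun y _ => ?_
    rw [Finset.sum_mul]
    refine Finset.sum_congr rfl fun x _ => ?_
    rw [AddChar.map_add_eq_mul]; ring
  simp_rw [h1, gg_parseval1]
  rw [← Finset.mul_sum, Finset.sum_comm]
  simp_rw [gg_parseval1]
  rw [Fintype.sum_prod_type_right, ← Finset.mul_sum]
  simp
  ring

lemma gg_shift {N : ℕ} [NeZero N] (f : ZMod N × ZMod N → ℝ)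
    (s t : ZMod N × ZMod N → ZMod N × ZMod N) (hst : ∀ v, t (s v) = v) (hts : ∀ v, s (t v) = v)
    (a b a' b' c : ZMod N)
    (h : ∀ v, a * (t v).1 + b * (t v).2 = c + (a' * v.1 + b' * v.2)) :
    ∑ v, (f (s v) : ℂ) * ZMod.stdAddChar (a * v.1 + b * v.2) =
      ZMod.stdAddChar c * ggF f a' b' := by
  unfold ggF
  rw [Finset.mul_sum]
  refine Finset.sum_nbij' s t (by simp) (by simp) (by simp [hst]) (by simp [hts]) ?_
  intro v _
  have := h (s v)
  rw [hst] at this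
  rw [this, AddChar.map_add_eq_mul]; ring

lemma gg_trans {N : ℕ} [NeZero N] (f : ZMod N × ZMod N → ℝ) (a b : ZMod N) :
    ggF (fun v => 8 * ggO f v) a b =
      (1 + ZMod.stdAddChar a) * ggF f a (b + 2 * a) +
      (1 + ZMod.stdAddChar (-a)) * ggF f a (b - 2 * a) +
      (1 + ZMod.stdAddChar b) * ggF f (a + 2 * b) b +
      (1 + ZMod.stdAddChar (-b)) * ggF f (a - 2 * b) b := by
  have e1 := gg_shift f ggT1 ggT1inv (by intro v; simp [ggT1, ggT1inv])
    (by intro v; simp [ggT1, ggT1inv]) a b a (b - 2 * a) 0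
    (by intro v; simp only [ggT1inv]; ring)
  have e2 := gg_shift f (fun v => ggT1 v + ggE1) (fun v => ggT1inv (v - ggE1))
    (by intro v; ext <;> simp [ggT1, ggT1inv])
    (by intro v; ext <;> simp [ggT1, ggT1inv]) a b a (b - 2 * a) (-a)
    (by intro v; simp [ggT1inv, ggE1]; ring)
  have e3 := gg_shift f ggT2 ggT2inv (by intro v; simp [ggT2, ggT2inv])
    (by intro v; simp [ggT2, ggT2inv]) a b (a - 2 * b) b 0
    (by intro v; simp only [ggT2inv]; ring)
  have e4 := gg_shift f (fun v => ggT2 v + ggE2) (fun v => ggT2inv (v - ggE2))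
    (by intro v; ext <;> simp [ggT2, ggT2inv])
    (by intro v; ext <;> simp [ggT2, ggT2inv]) a b (a - 2 * b) b (-b)
    (by intro v; simp [ggT2inv, ggE2]; ring)
  have e5 := gg_shift f ggT1inv ggT1 (by intro v; simp [ggT1, ggT1inv])
    (by intro v; simp [ggT1, ggT1inv]) a b a (b + 2 * a) 0
    (by intro v; simp only [ggT1]; ring)
  have e6 := gg_shift f (fun v => ggT1inv (v - ggE1)) (fun v => ggT1 v + ggE1)
    (by intro v; ext <;> simp [ggT1, ggT1inv])
    (by intro v; ext <;> simp [ggT1, ggT1inv]) a b a (b + 2 * a) a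
    (by intro v; simp [ggT1, ggE1]; ring)
  have e7 := gg_shift f ggT2inv ggT2 (by intro v; simp [ggT2, ggT2inv])
    (by intro v; simp [ggT2, ggT2inv]) a b (a + 2 * b) b 0
    (by intro v; simp only [ggT2]; ring)
  have e8 := gg_shift f (fun v => ggT2inv (v - ggE2)) (fun v => ggT2 v + ggE2)
    (by intro v; ext <;> simp [ggT2, ggT2inv])
    (by intro v; ext <;> simp [ggT2, ggT2inv]) a b (a + 2 * b) b b
    (by intro v; simp [ggT2, ggE2]; ring)
  rw [AddChar.map_zero_eq_one] at e1 e3 e5 e7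
  have : ggF (fun v => 8 * ggO f v) a b =
      ∑ v, (f (ggT1 v) : ℂ) * ZMod.stdAddChar (a * v.1 + b * v.2) +
      ∑ v, (f (ggT1 v + ggE1) : ℂ) * ZMod.stdAddChar (a * v.1 + b * v.2) +
      ∑ v, (f (ggT2 v) : ℂ) * ZMod.stdAddChar (a * v.1 + b * v.2) +
      ∑ v, (f (ggT2 v + ggE2) : ℂ) * ZMod.stdAddChar (a * v.1 + b * v.2) +
      ∑ v, (f (ggT1inv v) : ℂ) * ZMod.stdAddChar (a * v.1 + b * v.2) +
      ∑ v, (f (ggT1inv (v - ggE1)) : ℂ) * ZMod.stdAddChar (a * v.1 + b * v.2) +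
      ∑ v, (f (ggT2inv v) : ℂ) * ZMod.stdAddChar (a * v.1 + b * v.2) +
      ∑ v, (f (ggT2inv (v - ggE2)) : ℂ) * ZMod.stdAddChar (a * v.1 + b * v.2) := by
    simp only [← Finset.sum_add_distrib]
    unfold ggF
    refine Finset.sum_congr rfl fun v _ => ?_
    unfold ggO
    push_cast
    ring
  rw [this, e1, e2, e3, e4, e5, e6, e7, e8]
  ring

lemma gg_cs (w g g' x : Fin 4 → ℝ) (hw : ∀ i, 0 ≤ w i) (hg : ∀ i, 0 < g i)
    (hg' : ∀ i, 0 < g' i) (h : ∀ i, g i * g' i = 1) :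
    (∑ i, w i * x i) ^ 2 ≤ (∑ i, w i * g i) * ∑ i, w i * (g' i * x i ^ 2) := by
  apply Finset.sum_sq_le_sum_mul_sum_of_sq_le_mul
  · intro i _; exact mul_nonneg (hw i) (hg i).le
  · intro i _; exact mul_nonneg (hw i) (mul_nonneg (hg' i).le (sq_nonneg _))
  · intro i _
    apply le_of_eq
    linear_combination (-(w i) ^ 2 * x i ^ 2) * h i

noncomputable def ggW {N : ℕ} (a : ZMod N) : ℝ := 2 * Real.cos (Real.pi * ggm a / N)

noncomputable def ggR {N : ℕ} [NeZero N] (f : ZMod N × ZMod N → ℝ) (a b : ZMod N) : ℝ :=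
  ggW a * (ggg (ggm (b + 2 * a)) (ggm b) * ‖ggF f a (b + 2 * a)‖ ^ 2) +
  ggW a * (ggg (ggm (b - 2 * a)) (ggm b) * ‖ggF f a (b - 2 * a)‖ ^ 2) +
  ggW b * (ggg (ggm (a + 2 * b)) (ggm a) * ‖ggF f (a + 2 * b) b‖ ^ 2) +
  ggW b * (ggg (ggm (a - 2 * b)) (ggm a) * ‖ggF f (a - 2 * b) b‖ ^ 2)

lemma ggW_nonneg {N : ℕ} [NeZero N] (a : ZMod N) : 0 ≤ ggW a := by
  have := (ggcos (N := N) (ggm a) (ggm_le a)).1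
  unfold ggW; positivity

lemma ggR_nonneg {N : ℕ} [NeZero N] (f : ZMod N × ZMod N → ℝ) (a b : ZMod N) :
    0 ≤ ggR f a b := by
  have h1 := ggW_nonneg a
  have h2 := ggW_nonneg b
  have h3 := fun p q => (ggg_nonneg p q).le
  unfold ggR
  have : ∀ w p q (z : ℂ), 0 ≤ w → 0 ≤ w * (ggg p q * ‖z‖ ^ 2) := fun w p q z hw =>
    mul_nonneg hw (mul_nonneg (h3 p q) (sq_nonneg _))
  have := this
  refine add_nonneg (add_nonneg (add_nonneg ?_ ?_) ?_) ?_ <;> apply this <;> assumption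

lemma gg_pt {N : ℕ} [NeZero N] (f : ZMod N × ZMod N → ℝ) (hF : ggF f 0 0 = 0)
    (a b : ZMod N) :
    ‖ggF (fun v => 8 * ggO f v) a b‖ ^ 2 ≤ 5 * √2 * ggR f a b := by
  have hR := ggR_nonneg f a b
  by_cases h : a = 0 ∧ b = 0
  · obtain ⟨rfl, rfl⟩ := h
    rw [gg_trans]
    simp only [mul_zero, add_zero, sub_zero, hF]
    rw [norm_zero, zero_pow two_ne_zero]
    exact mul_nonneg (by positivity) hR
  have hk := gg_key a b h
  have h1 : ‖ggF (fun v => 8 * ggO f v) a b‖ ≤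
      ggW a * ‖ggF f a (b + 2 * a)‖ + ggW a * ‖ggF f a (b - 2 * a)‖ +
      ggW b * ‖ggF f (a + 2 * b) b‖ + ggW b * ‖ggF f (a - 2 * b) b‖ := by
    rw [gg_trans]
    refine (norm_add₄_le).trans (le_of_eq ?_)
    simp only [norm_mul, (gg_norm a).1, (gg_norm a).2, (gg_norm b).1, (gg_norm b).2, ggW]
  have h2 := gg_cs ![ggW a, ggW a, ggW b, ggW b]
    ![ggg (ggm b) (ggm (b + 2 * a)), ggg (ggm b) (ggm (b - 2 * a)),
      ggg (ggm a) (ggm (a + 2 * b)), ggg (ggm a) (ggm (a - 2 * b))]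
    ![ggg (ggm (b + 2 * a)) (ggm b), ggg (ggm (b - 2 * a)) (ggm b),
      ggg (ggm (a + 2 * b)) (ggm a), ggg (ggm (a - 2 * b)) (ggm a)]
    ![‖ggF f a (b + 2 * a)‖, ‖ggF f a (b - 2 * a)‖, ‖ggF f (a + 2 * b) b‖,
      ‖ggF f (a - 2 * b) b‖]
    (by intro i; fin_cases i <;> simp [ggW_nonneg])
    (by intro i; fin_cases i <;> simp [ggg_nonneg])
    (by intro i; fin_cases i <;> simp [ggg_nonneg])
    (by intro i; fin_cases i <;> simp [ggg_inv])
  simp only [Fin.sum_univ_four, Matrix.cons_val] at h2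
  refine (pow_le_pow_left₀ (norm_nonneg _) h1 2).trans (h2.trans ?_)
  unfold ggR at hR ⊢
  refine mul_le_mul_of_nonneg_right ?_ hR
  unfold ggG at hk
  unfold ggW
  linarith

lemma gg_sumR {N : ℕ} [NeZero N] (f : ZMod N × ZMod N → ℝ) :
    ∑ a, ∑ b, ggR f a b = ∑ a, ∑ b, (ggW a * ggG a b + ggW b * ggG b a) * ‖ggF f a b‖ ^ 2 := by
  have h1 : ∑ a, ∑ b, ggW a * (ggg (ggm (b + 2 * a)) (ggm b) * ‖ggF f a (b + 2 * a)‖ ^ 2) =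
      ∑ a, ∑ b, ggW a * (ggg (ggm b) (ggm (b - 2 * a)) * ‖ggF f a b‖ ^ 2) :=
    Finset.sum_congr rfl fun a _ =>
      Fintype.sum_equiv (Equiv.addRight (2 * a)) _ _ (by intro b; simp)
  have h2 : ∑ a, ∑ b, ggW a * (ggg (ggm (b - 2 * a)) (ggm b) * ‖ggF f a (b - 2 * a)‖ ^ 2) =
      ∑ a, ∑ b, ggW a * (ggg (ggm b) (ggm (b + 2 * a)) * ‖ggF f a b‖ ^ 2) :=
    Finset.sum_congr rfl fun a _ =>
      Fintype.sum_equiv (Equiv.subRight (2 * a)) _ _ (by intro b; simp)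
  have h3 : ∑ a, ∑ b, ggW b * (ggg (ggm (a + 2 * b)) (ggm a) * ‖ggF f (a + 2 * b) b‖ ^ 2) =
      ∑ a, ∑ b, ggW b * (ggg (ggm a) (ggm (a - 2 * b)) * ‖ggF f a b‖ ^ 2) := by
    rw [Finset.sum_comm, Finset.sum_comm (s := Finset.univ) (t := Finset.univ)
      (f := fun a b => ggW b * (ggg (ggm a) (ggm (a - 2 * b)) * ‖ggF f a b‖ ^ 2))]
    exact Finset.sum_congr rfl fun b _ =>
      Fintype.sum_equiv (Equiv.addRight (2 * b)) _ _ (by intro a; simp)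
  have h4 : ∑ a, ∑ b, ggW b * (ggg (ggm (a - 2 * b)) (ggm a) * ‖ggF f (a - 2 * b) b‖ ^ 2) =
      ∑ a, ∑ b, ggW b * (ggg (ggm a) (ggm (a + 2 * b)) * ‖ggF f a b‖ ^ 2) := by
    rw [Finset.sum_comm, Finset.sum_comm (s := Finset.univ) (t := Finset.univ)
      (f := fun a b => ggW b * (ggg (ggm a) (ggm (a + 2 * b)) * ‖ggF f a b‖ ^ 2))]
    exact Finset.sum_congr rfl fun b _ =>
      Fintype.sum_equiv (Equiv.subRight (2 * b)) _ _ (by intro a; simp)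
  unfold ggR
  simp only [Finset.sum_add_distrib]
  rw [h1, h2, h3, h4]
  simp only [← Finset.sum_add_distrib]
  refine Finset.sum_congr rfl fun a _ => Finset.sum_congr rfl fun b _ => ?_
  unfold ggG
  ring

lemma gg_main {N : ℕ} [NeZero N] (f : ZMod N × ZMod N → ℝ)
    (hsum : ∑ v : ZMod N × ZMod N, f v = 0) :
    ∑ v, (8 * ggO f v) ^ 2 ≤ 50 * ∑ v, f v ^ 2 := by
  have hN : (0 : ℝ) < N := by exact_mod_cast Nat.pos_of_ne_zero (NeZero.ne N)
  have hF : ggF f 0 0 = 0 := by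
    unfold ggF
    simp only [zero_mul, add_zero, AddChar.map_zero_eq_one, mul_one]
    exact_mod_cast hsum
  have hs : √2 * √2 = 2 := Real.mul_self_sqrt (by norm_num)
  have h1 : ∑ a, ∑ b, ‖ggF (fun v => 8 * ggO f v) a b‖ ^ 2 ≤
      5 * √2 * ∑ a, ∑ b, ggR f a b := by
    simp only [Finset.mul_sum]
    exact Finset.sum_le_sum fun a _ => Finset.sum_le_sum fun b _ => gg_pt f hF a b
  have h2 : ∑ a, ∑ b, ggR f a b ≤ 5 * √2 * ∑ a, ∑ b, ‖ggF f a b‖ ^ 2 := by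
    rw [gg_sumR]
    simp only [Finset.mul_sum]
    refine Finset.sum_le_sum fun a _ => Finset.sum_le_sum fun b _ => ?_
    by_cases h : a = 0 ∧ b = 0
    · obtain ⟨rfl, rfl⟩ := h
      simp [hF]
    · exact mul_le_mul_of_nonneg_right (gg_key a b h) (sq_nonneg _)
  have h3 := mul_le_mul_of_nonneg_left h2 (by positivity : 0 ≤ 5 * √2)
  have h4 := h1.trans h3
  rw [gg_parseval, gg_parseval] at h4
  have h5 : (N : ℝ) ^ 2 * ∑ v, (8 * ggO f v) ^ 2 ≤ N ^ 2 * (50 * ∑ v, f v ^ 2) := by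
    refine h4.trans (le_of_eq ?_)
    linear_combination (25 * (N : ℝ) ^ 2 * ∑ v, f v ^ 2) * hs
  exact le_of_mul_le_mul_left h5 (by positivity)

/-- the Gabber–Galil spectral bound `5√2/8` for the Margulis expander,
uniformly in `N`. -/
theorem stmt_7 (N : ℕ) [NeZero N] (f : ZMod N × ZMod N → ℝ)
    (hsum : ∑ v : ZMod N × ZMod N, f v = 0) :
    Real.sqrt (∑ v : ZMod N × ZMod N, (ggO f v) ^ 2)
      ≤ (5 * Real.sqrt 2 / 8) * Real.sqrt (∑ v : ZMod N × ZMod N, (f v) ^ 2) := by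
  have h := gg_main f hsum
  have h1 : ∑ v, (ggO f v) ^ 2 ≤ (5 * √2 / 8) ^ 2 * ∑ v, f v ^ 2 := by
    simp only [mul_pow, ← Finset.mul_sum] at h
    rw [div_pow, mul_pow, Real.sq_sqrt (by norm_num)]
    linarith
  refine (Real.sqrt_le_sqrt h1).trans (le_of_eq ?_)
  rw [Real.sqrt_mul (by positivity), Real.sqrt_sq (by positivity)]
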